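/- Define the degree of a partial permutation (d,σ) (d a finite set, σ a permutation of d) as |d| − (number of cycles of σ) + (number of fixed points of σ). Then degree is subadditive under the product of partial permutations: deg((d,σ)·(d',σ')) ≤ deg(d,σ) + deg(d',σ'), where the product is (d∪d', σ̃·σ̃') with canonical extensions by fixed points. -/

import Mathlib

open Finset
open scoped Classical

/-- The number of fixed points of a permutation of (the coercion to a type of)
a finite set `d ⊆ ℕ`. -/
noncomputable def numFixed {d : Finset ℕ} (σ : Equiv.Perm ↥d) : ℕ :=
  (Finset.univ.filter (fun x : ↥d => σ x = x)).card

/-- The number of cycles of a permutation of `d`, fixed points included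
(the cycle type records the nontrivial cycles, to which we add the fixed points). -/
noncomputable def numCycles {d : Finset ℕ} (σ : Equiv.Perm ↥d) : ℕ :=
  σ.cycleType.card + numFixed σ

/-- The degree of a partial permutation `(d, σ)`:
`|d| − (number of cycles of σ) + (number of fixed points of σ)`. -/
noncomputable def pdeg (d : Finset ℕ) (σ : Equiv.Perm ↥d) : ℤ :=
  (d.card : ℤ) - numCycles σ + numFixed σ

/-- The canonical extension of a permutation of `d ⊆ ℕ` to a permutation of `ℕ`,
fixing every point outside `d`. -/
noncomputable def extNat {d : Finset ℕ} (σ : Equiv.Perm ↥d) : Equiv.Perm ℕ :=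
  σ.extendDomain (Equiv.refl ↥d)

section CycleCount

variable {α : Type*} [Fintype α] [DecidableEq α]

/-- The function on `α` that is constant on each nontrivial cycle of `σ`, with values
prescribed by `u`, and zero on the fixed points of `σ`. -/
noncomputable def cycleFun (σ : Equiv.Perm α) :
    (σ.cycleFactorsFinset → ℚ) →ₗ[ℚ] (α → ℚ) where
  toFun u x := if h : σ.cycleOf x ∈ σ.cycleFactorsFinset then u ⟨_, h⟩ else 0
  map_add' u v := by ext x; by_cases h : σ.cycleOf x ∈ σ.cycleFactorsFinset <;> simp [h]
  map_smul' a u := by ext x; by_cases h : σ.cycleOf x ∈ σ.cycleFactorsFinset <;> simp [h]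

theorem cycleFun_apply_perm (σ : Equiv.Perm α) (u : σ.cycleFactorsFinset → ℚ) (x : α) :
    cycleFun σ u (σ x) = cycleFun σ u x := by
  have h : σ.cycleOf (σ x) = σ.cycleOf x :=
    (Equiv.Perm.sameCycle_apply_left.2 (Equiv.Perm.SameCycle.refl σ x)).cycleOf_eq
  simp only [cycleFun, LinearMap.coe_mk, AddHom.coe_mk, h]

theorem cycleFun_eq_zero_of_fixed (σ : Equiv.Perm α) (u : σ.cycleFactorsFinset → ℚ) {x : α}
    (hx : σ x = x) : cycleFun σ u x = 0 := by
  have h : σ.cycleOf x ∉ σ.cycleFactorsFinset := by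
    rw [Equiv.Perm.cycleOf_mem_cycleFactorsFinset_iff]
    simpa using hx
  simp only [cycleFun, LinearMap.coe_mk, AddHom.coe_mk, dif_neg h]

theorem cycleFun_injective (σ : Equiv.Perm α) : Function.Injective (cycleFun σ) := by
  rw [← LinearMap.ker_eq_bot, LinearMap.ker_eq_bot']
  intro u hu
  ext ⟨c, hc⟩
  obtain ⟨x, hx⟩ := (Equiv.Perm.mem_cycleFactorsFinset_iff.1 hc).1.nonempty_support
  obtain rfl := Equiv.Perm.cycle_is_cycleOf hx hc
  have := congrFun hu x
  simpa only [cycleFun, LinearMap.coe_mk, AddHom.coe_mk, dif_pos hc, Pi.zero_apply] using this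

theorem exists_sameCycle_representatives (π : Equiv.Perm α) :
    ∃ r : π.cycleFactorsFinset → α, ∀ x, π x ≠ x → ∃ c, π.SameCycle (r c) x := by
  have h : ∀ c : π.cycleFactorsFinset, ∃ x, x ∈ c.1.support := fun c =>
    (Equiv.Perm.mem_cycleFactorsFinset_iff.1 c.2).1.nonempty_support
  choose r hr using h
  refine ⟨r, fun x hx => ?_⟩
  have hc : π.cycleOf x ∈ π.cycleFactorsFinset := by
    rw [Equiv.Perm.cycleOf_mem_cycleFactorsFinset_iff]
    simpa using hx
  refine ⟨⟨_, hc⟩, ?_⟩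
  have := hr ⟨_, hc⟩
  rw [Equiv.Perm.mem_support_cycleOf_iff] at this
  exact this.1.symm

/-- If `u, v` satisfy `cycleFun σ u = w * cycleFun τ v` on the common support for an injective
nonvanishing weight `w`, and both functions vanish at a representative of each nontrivial cycle
of `σ * τ`, then both functions vanish. -/
theorem cycleFun_eq_zero (σ τ : Equiv.Perm α) (w : α → ℚ) (hw : Function.Injective w)
    (hw0 : ∀ x, w x ≠ 0) (u : σ.cycleFactorsFinset → ℚ) (v : τ.cycleFactorsFinset → ℚ)
    (huv : ∀ x, σ x ≠ x → τ x ≠ x → cycleFun σ u x = w x * cycleFun τ v x)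
    (hz : ∀ x, (σ * τ) x ≠ x → ∃ y, (σ * τ).SameCycle y x ∧
      cycleFun σ u y = 0 ∧ cycleFun τ v y = 0) (x : α) :
    cycleFun σ u x = 0 ∧ cycleFun τ v x = 0 := by
  have hf := cycleFun_apply_perm σ u
  have hg := cycleFun_apply_perm τ v
  have hf0 := fun x => cycleFun_eq_zero_of_fixed σ u (x := x)
  have hg0 := fun x => cycleFun_eq_zero_of_fixed τ v (x := x)
  generalize cycleFun σ u = f at *
  generalize cycleFun τ v = g at *
  have hσ : ∀ x, f x = 0 ∧ g x = 0 → f (σ x) = 0 ∧ g (σ x) = 0 := by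
    rintro x ⟨h1, h2⟩
    refine ⟨(hf x).trans h1, ?_⟩
    by_cases h3 : σ (σ x) = σ x
    · rw [σ.injective h3, h2]
    by_cases h4 : τ (σ x) = σ x
    · exact hg0 _ h4
    have := huv _ h3 h4
    rw [hf, h1] at this
    exact (mul_eq_zero.1 this.symm).resolve_left (hw0 _)
  have hτ : ∀ x, f x = 0 ∧ g x = 0 → f (τ x) = 0 ∧ g (τ x) = 0 := by
    rintro x ⟨h1, h2⟩
    refine ⟨?_, (hg x).trans h2⟩
    by_cases h3 : τ (τ x) = τ x
    · rw [τ.injective h3, h1]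
    by_cases h4 : σ (τ x) = τ x
    · exact hf0 _ h4
    rw [huv _ h4 h3, hg, h2, mul_zero]
  have key : ∀ x, (σ * τ) x ≠ x → f x = 0 ∧ g x = 0 := by
    intro x hx
    obtain ⟨y, hy, hy0⟩ := hz x hx
    obtain ⟨n, -, -, rfl⟩ := hy.exists_pow_eq'
    clear hx hy
    induction n with
    | zero => simpa using hy0
    | succ n ih =>
      rw [pow_succ', Equiv.Perm.mul_apply, Equiv.Perm.mul_apply]
      exact hσ _ (hτ _ ih)
  by_cases hx : (σ * τ) x = x
  swap
  · exact key x hx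
  have hx' : σ (τ x) = x := hx
  by_cases hτx : τ x = x
  · rw [hτx] at hx'
    exact ⟨hf0 _ hx', hg0 _ hτx⟩
  by_cases hy : (σ * τ) (τ x) = τ x
  swap
  · have := hσ _ (key _ hy)
    rwa [hx'] at this
  have hσx : σ x ≠ x := fun h => hτx (σ.injective (hx'.trans h.symm))
  have e1 := huv x hσx hτx
  have e2 := huv (τ x) (by rw [hx']; exact Ne.symm hτx) (fun h => hτx (τ.injective h))
  rw [hg, ← hf, hx'] at e2
  have hg' : g x = 0 := by
    have : (w (τ x) - w x) * g x = 0 := by linarith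
    exact (mul_eq_zero.1 this).resolve_left (sub_ne_zero.2 fun h => hτx (hw h))
  exact ⟨by rw [e1, hg', mul_zero], hg'⟩

theorem card_cycleType_add_card_cycleType_le (σ τ : Equiv.Perm α) :
    σ.cycleType.card + τ.cycleType.card ≤
      (σ.support ∩ τ.support).card + (σ * τ).cycleType.card := by
  obtain ⟨w, hw, hw0⟩ : ∃ w : α → ℚ, Function.Injective w ∧ ∀ x, w x ≠ 0 := by
    refine ⟨fun x => ((Fintype.equivFin α x : ℕ) : ℚ) + 1, fun x y h => ?_, fun x => by positivity⟩
    simpa [Fin.val_inj] using h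
  obtain ⟨r, hr⟩ := exists_sameCycle_representatives (σ * τ)
  let F := cycleFun σ ∘ₗ LinearMap.fst ℚ (σ.cycleFactorsFinset → ℚ) (τ.cycleFactorsFinset → ℚ)
  let G := cycleFun τ ∘ₗ LinearMap.snd ℚ (σ.cycleFactorsFinset → ℚ) (τ.cycleFactorsFinset → ℚ)
  let L₁ := LinearMap.pi fun x : ↥(σ.support ∩ τ.support) =>
    LinearMap.proj x.1 ∘ₗ F - w x.1 • LinearMap.proj x.1 ∘ₗ G
  let L₂ := LinearMap.pi fun c : ↥(σ * τ).cycleFactorsFinset =>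
    if σ (r c) = r c then LinearMap.proj (r c) ∘ₗ G else LinearMap.proj (r c) ∘ₗ F
  have hinj : Function.Injective (L₁.prod L₂) := by
    rw [← LinearMap.ker_eq_bot, LinearMap.ker_eq_bot']
    rintro ⟨u, v⟩ huv
    have h₁ : ∀ x, σ x ≠ x → τ x ≠ x → cycleFun σ u x = w x * cycleFun τ v x := by
      intro x h1 h2
      have := congrFun (congrArg Prod.fst huv) ⟨x, by simp [h1, h2]⟩
      simpa [L₁, F, G, sub_eq_zero] using this
    have h₂ : ∀ c, cycleFun σ u (r c) = 0 ∧ cycleFun τ v (r c) = 0 := by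
      intro c
      have := congrFun (congrArg Prod.snd huv) c
      by_cases h : σ (r c) = r c
      · exact ⟨cycleFun_eq_zero_of_fixed σ u h, by simpa [L₂, F, G, h] using this⟩
      · have hu : cycleFun σ u (r c) = 0 := by simpa [L₂, F, G, h] using this
        refine ⟨hu, ?_⟩
        by_cases h' : τ (r c) = r c
        · exact cycleFun_eq_zero_of_fixed τ v h'
        · have := h₁ _ h h'
          rw [hu] at this
          exact (mul_eq_zero.1 this.symm).resolve_left (hw0 _)
    have h := cycleFun_eq_zero σ τ w hw hw0 u v h₁ fun x hx =>
      (hr x hx).imp' r fun c hc => ⟨hc, h₂ c⟩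
    refine Prod.ext (cycleFun_injective σ ?_) (cycleFun_injective τ ?_)
    · rw [Prod.fst_zero, map_zero]; exact funext fun x => (h x).1
    · rw [Prod.snd_zero, map_zero]; exact funext fun x => (h x).2
  have := LinearMap.finrank_le_finrank_of_injective hinj
  simpa only [Equiv.Perm.cycleType_def, Multiset.card_map, card_val, Module.finrank_prod,
    Module.finrank_pi, Fintype.card_coe] using this

end CycleCount

theorem pdeg_eq_card_sub_card_cycleType (d : Finset ℕ) (σ : Equiv.Perm ↥d) :
    pdeg d σ = d.card - σ.cycleType.card := by
  simp only [pdeg, numCycles, Nat.cast_add]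
  ring

/-- A finite set `d` as a subtype of a larger finite set. -/
def subtypeEquivOfSubset {d s : Finset ℕ} (h : d ⊆ s) : ↥d ≃ {x : ↥s // (x : ℕ) ∈ d} where
  toFun x := ⟨⟨x, h x.2⟩, x.2⟩
  invFun x := ⟨x.1, x.2⟩

theorem coe_extendDomain_subtypeEquivOfSubset {d s : Finset ℕ} (h : d ⊆ s)
    (σ : Equiv.Perm ↥d) (x : ↥s) :
    (σ.extendDomain (subtypeEquivOfSubset h) x : ℕ) = extNat σ x := by
  by_cases hx : (x : ℕ) ∈ d
  · rw [extNat, Equiv.Perm.extendDomain_apply_subtype σ (subtypeEquivOfSubset h) hx,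
      Equiv.Perm.extendDomain_apply_subtype σ (Equiv.refl ↥d) hx]
    rfl
  · rw [extNat, Equiv.Perm.extendDomain_apply_not_subtype σ (subtypeEquivOfSubset h) hx,
      Equiv.Perm.extendDomain_apply_not_subtype σ (Equiv.refl ↥d) hx]

/-- The degree of partial permutations is subadditive under the product
`(d,σ)·(d',τ) = (d ∪ d', σ̃ τ̃)`: here `π` is the permutation of `d ∪ e` whose
extension to `ℕ` is `σ̃ · τ̃`. -/
theorem pdeg_mul_le (d e : Finset ℕ) (σ : Equiv.Perm ↥d) (τ : Equiv.Perm ↥e)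
    (π : Equiv.Perm ↥(d ∪ e))
    (hπ : ∀ x : ↥(d ∪ e), (π x : ℕ) = (extNat σ * extNat τ) ↑x) :
    pdeg (d ∪ e) π ≤ pdeg d σ + pdeg e τ := by
  let σ' := σ.extendDomain (subtypeEquivOfSubset (subset_union_left : d ⊆ d ∪ e))
  let τ' := τ.extendDomain (subtypeEquivOfSubset (subset_union_right : e ⊆ d ∪ e))
  have hπ' : π = σ' * τ' := by
    ext x
    rw [hπ, Equiv.Perm.mul_apply, Equiv.Perm.mul_apply, coe_extendDomain_subtypeEquivOfSubset,
      coe_extendDomain_subtypeEquivOfSubset]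
  have hI : (σ'.support ∩ τ'.support).card ≤ (d ∩ e).card := by
    refine card_le_card_of_injOn (fun x => (x : ℕ)) (fun x hx => ?_)
      (Subtype.val_injective.injOn)
    simp only [coe_inter, Set.mem_inter_iff, mem_coe, Equiv.Perm.mem_support] at hx ⊢
    constructor
    · by_contra h
      exact hx.1 (Equiv.Perm.extendDomain_apply_not_subtype _ _ h)
    · by_contra h
      exact hx.2 (Equiv.Perm.extendDomain_apply_not_subtype _ _ h)
  have hle := card_cycleType_add_card_cycleType_le σ' τ'
  rw [← hπ', Equiv.Perm.cycleType_extendDomain, Equiv.Perm.cycleType_extendDomain] at hle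
  have hcard := card_union_add_card_inter d e
  simp only [pdeg_eq_card_sub_card_cycleType]
  omega
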